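/- Every ℝ-linear map f from the quaternions to the quaternions can be written in the alternative canonic form f(q) = A·q + q·b + v_1·q·i + v_2·q·j + v_3·q·k, where A is a quaternion and b, v_1, v_2, v_3 are pure quaternions (quaternions with zero real part); this form has 16 real coefficients in total. -/

import Mathlib

open scoped Quaternion

/-- The imaginary units of the real quaternions. -/
def qi : ℍ[ℝ] := ⟨0, 1, 0, 0⟩
def qj : ℍ[ℝ] := ⟨0, 0, 1, 0⟩
def qk : ℍ[ℝ] := ⟨0, 0, 0, 1⟩

@[simp] theorem qi_re : qi.re = 0 := rfl
@[simp] theorem qi_imI : qi.imI = 1 := rfl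
@[simp] theorem qi_imJ : qi.imJ = 0 := rfl
@[simp] theorem qi_imK : qi.imK = 0 := rfl

@[simp] theorem qj_re : qj.re = 0 := rfl
@[simp] theorem qj_imI : qj.imI = 0 := rfl
@[simp] theorem qj_imJ : qj.imJ = 1 := rfl
@[simp] theorem qj_imK : qj.imK = 0 := rfl

@[simp] theorem qk_re : qk.re = 0 := rfl
@[simp] theorem qk_imI : qk.imI = 0 := rfl
@[simp] theorem qk_imJ : qk.imJ = 0 := rfl
@[simp] theorem qk_imK : qk.imK = 1 := rfl

/-- The expansion of an `ℝ`-linear map out of the quaternions along the basis `1, i, j, k`. -/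
theorem quaternion_linearMap_apply (f : ℍ[ℝ] →ₗ[ℝ] ℍ[ℝ]) (q : ℍ[ℝ]) :
    f q = q.re • f 1 + q.imI • f qi + q.imJ • f qj + q.imK • f qk := by
  simp only [← map_smul, ← map_add]
  congr 1
  ext <;> simp

/-- every ℝ-linear map `ℍ → ℍ` can be written in the alternative canonic form
`f(q) = A q + q b + v₁ q i + v₂ q j + v₃ q k` with `b, v₁, v₂, v₃` pure quaternions. -/
theorem stmt_13 (f : ℍ[ℝ] →ₗ[ℝ] ℍ[ℝ]) :
    ∃ A b v₁ v₂ v₃ : ℍ[ℝ],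
      b.re = 0 ∧ v₁.re = 0 ∧ v₂.re = 0 ∧ v₃.re = 0 ∧
      ∀ q : ℍ[ℝ], f q = A * q + q * b + v₁ * q * qi + v₂ * q * qj + v₃ * q * qk := by
  let p (e : ℍ[ℝ]) : ℍ[ℝ] :=
    (1 / 4 : ℝ) • (f 1 * star e - f qi * star e * qi - f qj * star e * qj - f qk * star e * qk)
  refine ⟨p 1, (p qi).re • qi + (p qj).re • qj + (p qk).re • qk, (p qi).im, (p qj).im, (p qk).im,
    by simp, by simp, by simp, by simp, fun q => ?_⟩
  rw [quaternion_linearMap_apply f q]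
  simp only [p]
  generalize f 1 = x, f qi = y, f qj = z, f qk = w
  ext <;> simp <;> ring
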